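/- Let Ω ⊆ ℝ² be open and bounded, with ∂Ω a one-dimensional C¹ submanifold of ℝ², and assume every point of ∂Ω satisfies the interior ball condition. Let λ ≥ 0 be a real number and let φ : ℝ² → ℝ be continuously differentiable on an open neighborhood of the closure of Ω, twice continuously differentiable on Ω, with Δφ + λ·φ = 0 on Ω and φ = 0 on ∂Ω. Then for every P ∈ ∂Ω: fderiv φ P = 0 if and only if P belongs to the closure of {x ∈ Ω : φ(x) = 0}. -/

import Mathlib

/-- Partial derivative in the first coordinate direction. -/
noncomputable def pd1 (f : ℝ × ℝ → ℝ) (p : ℝ × ℝ) : ℝ := fderiv ℝ f p (1, 0)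

/-- Partial derivative in the second coordinate direction. -/
noncomputable def pd2 (f : ℝ × ℝ → ℝ) (p : ℝ × ℝ) : ℝ := fderiv ℝ f p (0, 1)

/-- The Laplacian `Δφ = ∂²φ/∂x² + ∂²φ/∂y²`. -/
noncomputable def lap (f : ℝ × ℝ → ℝ) (p : ℝ × ℝ) : ℝ :=
  pd1 (pd1 f) p + pd2 (pd2 f) p

/-- `M` is a one-dimensional C¹ submanifold of `ℝ²`: near each of its points it is
the image of a regular C¹ local parametrization. -/
def IsC1Submanifold1D (M : Set (ℝ × ℝ)) : Prop :=
  ∀ Q ∈ M, ∃ (U : Set (ℝ × ℝ)) (γ : ℝ → ℝ × ℝ) (ε : ℝ),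
    0 < ε ∧ IsOpen U ∧ Q ∈ U ∧
    ContDiffOn ℝ 1 γ (Set.Ioo (-ε) ε) ∧ γ 0 = Q ∧
    deriv γ 0 ≠ 0 ∧ γ '' Set.Ioo (-ε) ε = M ∩ U

/-- `P` satisfies the interior ball condition for `Ω`: there is an open (Euclidean)
ball contained in `Ω` whose boundary contains `P`. -/
def InteriorBall (Ω : Set (ℝ × ℝ)) (P : ℝ × ℝ) : Prop :=
  ∃ (c : ℝ × ℝ) (ρ : ℝ), 0 < ρ ∧
    {x : ℝ × ℝ | (x.1 - c.1) ^ 2 + (x.2 - c.2) ^ 2 < ρ ^ 2} ⊆ Ω ∧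
    (P.1 - c.1) ^ 2 + (P.2 - c.2) ^ 2 = ρ ^ 2

open Filter Topology

/-- Necessary second-order condition for a local minimum on the line. -/
lemma IsLocalMin.second_deriv_nonneg {f f' : ℝ → ℝ} {a d : ℝ} (hmin : IsLocalMin f a)
    (hf : ∀ᶠ t in 𝓝 a, HasDerivAt f (f' t) t) (hf' : HasDerivAt f' d a) : 0 ≤ d := by
  by_contra! hd
  have hderiv : deriv f =ᶠ[𝓝 a] f' := hf.mono fun t ht => ht.deriv
  have hdd : deriv (deriv f) a = d := by rw [hderiv.deriv_eq, hf'.deriv]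
  have hmax : IsLocalMax f a :=
    isLocalMax_of_deriv_deriv_neg (by rw [hdd]; exact hd) hmin.deriv_eq_zero
      hf.self_of_nhds.continuousAt
  have hconst : f =ᶠ[𝓝 a] fun _ => f a := by
    filter_upwards [hmin, hmax] with t h1 h2 using le_antisymm h2 h1
  have hzero : deriv (deriv f) a = 0 := by
    rw [hconst.deriv.deriv_eq]; simp
  linarith

lemma differentiableAt_fderiv_apply {u : ℝ × ℝ → ℝ} {x : ℝ × ℝ} (hu : ContDiffAt ℝ 2 u x)
    (e : ℝ × ℝ) : DifferentiableAt ℝ (fun p => fderiv ℝ u p e) x :=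
  ((hu.fderiv_right (m := 1) (by norm_num)).differentiableAt (by norm_num)).clm_apply
    (differentiableAt_const e)

lemma IsLocalMin.fderiv_fderiv_apply_nonneg {u : ℝ × ℝ → ℝ} {x : ℝ × ℝ}
    (hmin : IsLocalMin u x) (hu : ContDiffAt ℝ 2 u x) (e : ℝ × ℝ) :
    0 ≤ fderiv ℝ (fun p => fderiv ℝ u p e) x e := by
  have hline : ∀ t : ℝ, HasDerivAt (fun t : ℝ => x + t • e) e t := fun t => by
    simpa using ((hasDerivAt_id t).smul_const e).const_add x
  have hx : x + (0 : ℝ) • e = x := by simp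
  have htend : Tendsto (fun t : ℝ => x + t • e) (𝓝 0) (𝓝 x) := by
    simpa [hx] using (hline 0).continuousAt.tendsto
  have hdiff : ∀ᶠ p in 𝓝 x, DifferentiableAt ℝ u p :=
    (hu.eventually (by simp)).mono fun p hp => hp.differentiableAt (by norm_num)
  refine IsLocalMin.second_deriv_nonneg (f := fun t : ℝ => u (x + t • e))
    (f' := fun t : ℝ => fderiv ℝ u (x + t • e) e) (a := 0) ?_ ?_ ?_
  · simpa [IsLocalMin, IsMinFilter] using htend.eventually hmin
  · filter_upwards [htend.eventually hdiff] with t ht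
    exact ht.hasFDerivAt.comp_hasDerivAt t (hline t)
  · have h := (differentiableAt_fderiv_apply hu e).hasFDerivAt
    exact HasFDerivAt.comp_hasDerivAt_of_eq (x := (0 : ℝ)) h (hline 0) hx.symm

lemma IsLocalMin.lap_nonneg {u : ℝ × ℝ → ℝ} {x : ℝ × ℝ}
    (hmin : IsLocalMin u x) (hu : ContDiffAt ℝ 2 u x) : 0 ≤ lap u x :=
  add_nonneg (hmin.fderiv_fderiv_apply_nonneg hu (1, 0))
    (hmin.fderiv_fderiv_apply_nonneg hu (0, 1))

lemma fderiv_fderiv_apply_sub_const_mul {u v : ℝ × ℝ → ℝ} {x : ℝ × ℝ}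
    (hu : ContDiffAt ℝ 2 u x) (hv : ContDiffAt ℝ 2 v x) (k : ℝ) (e : ℝ × ℝ) :
    fderiv ℝ (fun p => fderiv ℝ (fun y => u y - k * v y) p e) x e =
      fderiv ℝ (fun p => fderiv ℝ u p e) x e - k * fderiv ℝ (fun p => fderiv ℝ v p e) x e := by
  have h : (fun p => fderiv ℝ (fun y => u y - k * v y) p e) =ᶠ[𝓝 x]
      fun p => fderiv ℝ u p e - k * fderiv ℝ v p e := by
    filter_upwards [hu.eventually (by simp), hv.eventually (by simp)] with p h1 h2
    have d1 := (h1.differentiableAt (by norm_num)).hasFDerivAt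
    have d2 := (h2.differentiableAt (by norm_num)).hasFDerivAt
    refine (congrArg (fun L => L e) (d1.sub (d2.const_mul k)).fderiv).trans ?_
    simp
  rw [h.fderiv_eq]
  have d1 := (differentiableAt_fderiv_apply hu e).hasFDerivAt
  have d2 := (differentiableAt_fderiv_apply hv e).hasFDerivAt
  refine (congrArg (fun L => L e) (d1.sub (d2.const_mul k)).fderiv).trans ?_
  simp

lemma lap_sub_const_mul {u v : ℝ × ℝ → ℝ} {x : ℝ × ℝ}
    (hu : ContDiffAt ℝ 2 u x) (hv : ContDiffAt ℝ 2 v x) (k : ℝ) :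
    lap (fun y => u y - k * v y) x = lap u x - k * lap v x := by
  have h1 := fderiv_fderiv_apply_sub_const_mul hu hv k (1, 0)
  have h2 := fderiv_fderiv_apply_sub_const_mul hu hv k (0, 1)
  unfold lap pd1 pd2
  rw [h1, h2]
  ring

lemma lap_neg (u : ℝ × ℝ → ℝ) (x : ℝ × ℝ) : lap (fun y => -u y) x = -lap u x := by
  have h1 : pd1 (fun y => -u y) = fun y => -pd1 u y := by
    funext y; simp [pd1, fderiv_fun_neg]
  have h2 : pd2 (fun y => -u y) = fun y => -pd2 u y := by
    funext y; simp [pd2, fderiv_fun_neg]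
  have h3 : pd1 (fun y => -pd1 u y) x = -pd1 (pd1 u) x := by
    rw [pd1, fderiv_fun_neg]; rfl
  have h4 : pd2 (fun y => -pd2 u y) x = -pd2 (pd2 u) x := by
    rw [pd2, fderiv_fun_neg]; rfl
  unfold lap
  rw [h1, h2, h3, h4]
  ring

/-- The squared Euclidean distance to `c`. -/
def sqDist (c x : ℝ × ℝ) : ℝ := (x.1 - c.1) ^ 2 + (x.2 - c.2) ^ 2

lemma continuous_sqDist (c : ℝ × ℝ) : Continuous (sqDist c) := by
  unfold sqDist; fun_prop

lemma contDiff_sqDist (c : ℝ × ℝ) : ContDiff ℝ 2 (sqDist c) := by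
  unfold sqDist; fun_prop

lemma fderiv_sqDist_apply (c x e : ℝ × ℝ) :
    fderiv ℝ (sqDist c) x e = 2 * (x.1 - c.1) * e.1 + 2 * (x.2 - c.2) * e.2 := by
  have h1 : HasFDerivAt (fun p : ℝ × ℝ => p.1 - c.1) (ContinuousLinearMap.fst ℝ ℝ ℝ) x :=
    hasFDerivAt_fst.sub_const _
  have h2 : HasFDerivAt (fun p : ℝ × ℝ => p.2 - c.2) (ContinuousLinearMap.snd ℝ ℝ ℝ) x :=
    hasFDerivAt_snd.sub_const _
  have h := (h1.pow 2).add (h2.pow 2)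
  have h' : fderiv ℝ (sqDist c) x = _ := h.fderiv
  rw [h']
  simp

lemma sqDist_lineMap (c x : ℝ × ℝ) (t : ℝ) :
    sqDist c (c + t • (x - c)) = t ^ 2 * sqDist c x := by
  simp [sqDist]; ring

lemma dist_le_of_sqDist_le {c x : ℝ × ℝ} {R : ℝ} (hR : 0 ≤ R) (hx : sqDist c x ≤ R ^ 2) :
    dist x c ≤ R := by
  unfold sqDist at hx
  rw [Prod.dist_eq, max_le_iff, Real.dist_eq, Real.dist_eq]
  exact ⟨abs_le_of_sq_le_sq (by nlinarith [sq_nonneg (x.2 - c.2)]) hR,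
    abs_le_of_sq_le_sq (by nlinarith [sq_nonneg (x.1 - c.1)]) hR⟩

lemma isCompact_sqDist_le (c : ℝ × ℝ) {R : ℝ} (hR : 0 ≤ R) :
    IsCompact {x | sqDist c x ≤ R ^ 2} :=
  (isCompact_closedBall c R).of_isClosed_subset
    (isClosed_le (continuous_sqDist c) continuous_const) fun _ hx => dist_le_of_sqDist_le hR hx

lemma isOpen_sqDist_lt (c : ℝ × ℝ) (r : ℝ) : IsOpen {x | sqDist c x < r} :=
  isOpen_lt (continuous_sqDist c) continuous_const

lemma convex_sqDist_lt (c : ℝ × ℝ) (r : ℝ) : Convex ℝ {x | sqDist c x < r} := by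
  intro x hx y hy a b ha hb hab
  have hx' : sqDist c x < r := hx
  have hy' : sqDist c y < r := hy
  obtain rfl : b = 1 - a := by linarith
  have h : sqDist c (a • x + (1 - a) • y) =
      a * sqDist c x + (1 - a) * sqDist c y - a * (1 - a) * sqDist y x := by
    simp [sqDist]; ring
  have h0 : 0 ≤ a * (1 - a) * sqDist y x := by unfold sqDist; positivity
  have h1 : a * sqDist c x + (1 - a) * sqDist c y < r :=
    (convex_Iio r) hx' hy' ha hb hab
  simp only [Set.mem_ofPred_eq, h]
  linarith

lemma mem_closure_sqDist_lt {c x : ℝ × ℝ} {r : ℝ} (hr : 0 < r) (hx : sqDist c x ≤ r) :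
    x ∈ closure {x | sqDist c x < r} := by
  have htend : Tendsto (fun t : ℝ => c + t • (x - c)) (𝓝[<] 1) (𝓝 x) := by
    have : Tendsto (fun t : ℝ => c + t • (x - c)) (𝓝 1) (𝓝 (c + (1 : ℝ) • (x - c))) :=
      Continuous.tendsto (by fun_prop) 1
    simpa using this.mono_left nhdsWithin_le_nhds
  refine mem_closure_of_tendsto htend ?_
  filter_upwards [Ioo_mem_nhdsLT one_pos] with t ht
  have h1 : t ^ 2 < 1 := by nlinarith [ht.1, ht.2]
  rw [sqDist_lineMap]
  calc t ^ 2 * sqDist c x ≤ t ^ 2 * r := by gcongr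
    _ < r := by nlinarith

/-- A smaller disc touching a disc from inside at a boundary point is contained in it. -/
lemma sqDist_lt_of_internally_tangent {c P x : ℝ × ℝ} {ρ s : ℝ} (hs0 : 0 < s) (hs1 : s ≤ 1)
    (hP : sqDist c P = ρ ^ 2) (hx : sqDist (P + s • (c - P)) x < (s * ρ) ^ 2) :
    sqDist c x < ρ ^ 2 := by
  set A1 := x.1 - (P + s • (c - P)).1 with hA1
  set A2 := x.2 - (P + s • (c - P)).2 with hA2
  have hx' : A1 ^ 2 + A2 ^ 2 < (s * ρ) ^ 2 := hx
  unfold sqDist at hP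
  set B1 := P.1 - c.1 with hB1
  set B2 := P.2 - c.2 with hB2
  have e : sqDist c x = (A1 ^ 2 + A2 ^ 2) + 2 * (1 - s) * (A1 * B1 + A2 * B2)
      + (1 - s) ^ 2 * (B1 ^ 2 + B2 ^ 2) := by
    simp [sqDist, hA1, hA2, hB1, hB2]; ring
  have hdot : A1 * B1 + A2 * B2 ≤ s * ρ ^ 2 := by
    refine le_of_mul_le_mul_left ?_ hs0
    nlinarith [sq_nonneg (A1 - s * B1), sq_nonneg (A2 - s * B2)]
  rw [e, hP]
  nlinarith [mul_le_mul_of_nonneg_left hdot (by linarith : 0 ≤ 1 - s)]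

/-- The barrier function `1 / |x - c|²`. -/
noncomputable def barrier (c x : ℝ × ℝ) : ℝ := (sqDist c x)⁻¹

lemma contDiffAt_barrier {c x : ℝ × ℝ} (h : sqDist c x ≠ 0) : ContDiffAt ℝ 2 (barrier c) x :=
  (contDiff_sqDist c).contDiffAt.inv h

lemma fderiv_barrier_apply {c x : ℝ × ℝ} (h : sqDist c x ≠ 0) (e : ℝ × ℝ) :
    fderiv ℝ (barrier c) x e =
      -(2 * (x.1 - c.1) * e.1 + 2 * (x.2 - c.2) * e.2) / sqDist c x ^ 2 := by
  have hd := ((contDiff_sqDist c).differentiable (by norm_num) x).hasFDerivAt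
  have h' : fderiv ℝ (barrier c) x = _ := ((hasDerivAt_inv h).comp_hasFDerivAt x hd).fderiv
  rw [h', smul_apply, fderiv_sqDist_apply, smul_eq_mul]
  ring

lemma fderiv_fderiv_barrier_apply {c x : ℝ × ℝ} (h : sqDist c x ≠ 0) (e : ℝ × ℝ) :
    fderiv ℝ (fun p => fderiv ℝ (barrier c) p e) x e =
      -(2 * (e.1 ^ 2 + e.2 ^ 2)) / sqDist c x ^ 2 +
        8 * ((x.1 - c.1) * e.1 + (x.2 - c.2) * e.2) ^ 2 / sqDist c x ^ 3 := by
  have hev : (fun p => fderiv ℝ (barrier c) p e) =ᶠ[𝓝 x] fun p =>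
      -(2 * (p.1 - c.1) * e.1 + 2 * (p.2 - c.2) * e.2) * (barrier c p * barrier c p) := by
    filter_upwards [(continuous_sqDist c).continuousAt.eventually_ne h] with p hp
    rw [fderiv_barrier_apply hp, barrier]
    field_simp
  have h1 : HasFDerivAt (fun p : ℝ × ℝ => p.1 - c.1) (ContinuousLinearMap.fst ℝ ℝ ℝ) x :=
    hasFDerivAt_fst.sub_const _
  have h2 : HasFDerivAt (fun p : ℝ × ℝ => p.2 - c.2) (ContinuousLinearMap.snd ℝ ℝ ℝ) x :=
    hasFDerivAt_snd.sub_const _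
  have hb := ((contDiffAt_barrier h).differentiableAt (by norm_num)).hasFDerivAt
  have hd := ((((h1.const_mul 2).mul_const e.1).add ((h2.const_mul 2).mul_const e.2)).neg).mul
    (hb.mul hb)
  rw [hev.fderiv_eq]
  refine (congrArg (fun L => L e) hd.fderiv).trans ?_
  simp [fderiv_barrier_apply h]
  simp only [barrier]
  field_simp
  ring

lemma lap_barrier {c x : ℝ × ℝ} (h : sqDist c x ≠ 0) :
    lap (barrier c) x = 4 / sqDist c x ^ 2 := by
  have h1 := fderiv_fderiv_barrier_apply h (1, 0)
  have h2 := fderiv_fderiv_barrier_apply h (0, 1)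
  unfold lap pd1 pd2
  rw [h1, h2]
  field_simp
  simp only [sqDist]
  ring

/-- Hopf's boundary point lemma for superharmonic functions on a disc. -/
lemma hopf_boundary_point {c P : ℝ × ℝ} {R : ℝ} (hR : 0 < R) (hP : sqDist c P = R ^ 2)
    {u : ℝ × ℝ → ℝ} (hcont : ContinuousOn u {x | sqDist c x ≤ R ^ 2})
    (hC2 : ContDiffOn ℝ 2 u {x | sqDist c x < R ^ 2})
    (hpos : ∀ x, sqDist c x < R ^ 2 → 0 < u x)
    (hlap : ∀ x, sqDist c x < R ^ 2 → lap u x ≤ 0)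
    (huP : u P = 0) (hd : DifferentiableAt ℝ u P) : 0 < fderiv ℝ u P (c - P) := by
  have hR2 : 0 < R ^ 2 := by positivity
  have hnonneg : ∀ x, sqDist c x ≤ R ^ 2 → 0 ≤ u x := by
    intro x hx
    have hsub : {x | sqDist c x < R ^ 2} ⊆ {x | sqDist c x ≤ R ^ 2} :=
      fun y (hy : sqDist c y < R ^ 2) => hy.le
    have := mem_closure_iff_nhdsWithin_neBot.1 (mem_closure_sqDist_lt hR2 hx)
    exact ge_of_tendsto ((hcont x hx).mono hsub).tendsto
      (eventually_mem_nhdsWithin.mono fun y hy => (hpos y hy).le)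
  obtain ⟨m, hm, hum⟩ : ∃ m > 0, ∀ x, sqDist c x ≤ (R / 2) ^ 2 → m ≤ u x := by
    have hsub : {x | sqDist c x ≤ (R / 2) ^ 2} ⊆ {x | sqDist c x ≤ R ^ 2} := fun x hx =>
      le_trans (show sqDist c x ≤ (R / 2) ^ 2 from hx) (by nlinarith)
    obtain ⟨z, hz, hzmin⟩ := (isCompact_sqDist_le c (by positivity : (0 : ℝ) ≤ R / 2)).exists_isMinOn
      ⟨c, by simp [sqDist]; positivity⟩ (hcont.mono hsub)
    refine ⟨u z, hpos z (lt_of_le_of_lt hz (by nlinarith)), fun x hx => hzmin hx⟩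
  obtain ⟨k, hk, hkm⟩ : ∃ k > 0, k * (3 / R ^ 2) ≤ m :=
    ⟨m * R ^ 2 / 3, by positivity, le_of_eq (by field_simp)⟩
  set ψ : ℝ × ℝ → ℝ := fun x => u x - k * barrier c x with hψ
  have hcomp : ∀ x, (R / 2) ^ 2 ≤ sqDist c x → sqDist c x ≤ R ^ 2 →
      -(k * (R ^ 2)⁻¹) ≤ ψ x := by
    have hne : ∀ x, (R / 2) ^ 2 ≤ sqDist c x → sqDist c x ≠ 0 := fun x hx =>
      (lt_of_lt_of_le (by positivity) hx).ne'
    have hK : IsCompact ({x | sqDist c x ≤ R ^ 2} ∩ {x | (R / 2) ^ 2 ≤ sqDist c x}) :=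
      (isCompact_sqDist_le c hR.le).inter_right
        (isClosed_le continuous_const (continuous_sqDist c))
    have hψc : ContinuousOn ψ ({x | sqDist c x ≤ R ^ 2} ∩ {x | (R / 2) ^ 2 ≤ sqDist c x}) :=
      (hcont.mono Set.inter_subset_left).sub (continuousOn_const.mul fun x hx =>
        (contDiffAt_barrier (hne x hx.2)).continuousAt.continuousWithinAt)
    obtain ⟨z, ⟨hz1, hz2⟩, hzmin⟩ := hK.exists_isMinOn
      ⟨P, hP.le, by simp only [Set.mem_ofPred_eq, hP]; nlinarith⟩ hψc
    intro x hx1 hx2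
    refine le_trans ?_ (hzmin ⟨hx2, hx1⟩)
    simp only [Set.mem_ofPred_eq] at hz1 hz2
    rcases hz1.eq_or_lt with h1 | h1
    · have := hnonneg z hz1
      simp only [hψ, barrier, h1]
      linarith
    rcases hz2.eq_or_lt with h2 | h2
    · have := hum z h2.ge
      have h3 : (4 : ℝ) / R ^ 2 = ((R / 2) ^ 2)⁻¹ := by field_simp; norm_num
      simp only [hψ, barrier, ← h2, ← h3]
      have h4 : k * (4 / R ^ 2) = k * (3 / R ^ 2) + k * (R ^ 2)⁻¹ := by ring
      linarith
    · exfalso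
      have hball : {x | sqDist c x < R ^ 2} ∈ 𝓝 z :=
        (isOpen_sqDist_lt c _).mem_nhds h1
      have hloc : IsLocalMin ψ z := by
        filter_upwards [hball, (isOpen_lt continuous_const (continuous_sqDist c)).mem_nhds h2]
          with y hy1 hy2
        exact hzmin ⟨le_of_lt hy1, le_of_lt hy2⟩
      have hu2 : ContDiffAt ℝ 2 u z := hC2.contDiffAt hball
      have hb2 := contDiffAt_barrier (hne z hz2)
      have h0 := hloc.lap_nonneg (hu2.sub (contDiffAt_const.mul hb2))
      rw [hψ, lap_sub_const_mul hu2 hb2, lap_barrier (hne z hz2)] at h0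
      have : 0 < k * (4 / sqDist c z ^ 2) := by
        have := pow_pos (lt_of_lt_of_le (by positivity) hz2 : 0 < sqDist c z) 2
        positivity
      linarith [hlap z h1]
  have hPne : sqDist c P ≠ 0 := by rw [hP]; exact hR2.ne'
  have hψd : HasFDerivAt ψ (fderiv ℝ u P - k • fderiv ℝ (barrier c) P) P :=
    hd.hasFDerivAt.sub
      (((contDiffAt_barrier hPne).differentiableAt (by norm_num)).hasFDerivAt.const_mul k)
  have hline : HasDerivAt (fun t : ℝ => P + t • (c - P)) (c - P) 0 := by
    simpa using ((hasDerivAt_id (0 : ℝ)).smul_const (c - P)).const_add P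
  have hg : HasDerivAt (fun t : ℝ => ψ (P + t • (c - P)))
      ((fderiv ℝ u P - k • fderiv ℝ (barrier c) P) (c - P)) 0 :=
    HasFDerivAt.comp_hasDerivAt_of_eq (x := (0 : ℝ)) hψd hline (by simp)
  have hge : 0 ≤ (fderiv ℝ u P - k • fderiv ℝ (barrier c) P) (c - P) := by
    refine ge_of_tendsto (hg.tendsto_slope_zero_right) ?_
    filter_upwards [Ioo_mem_nhdsGT (show (0 : ℝ) < 1 / 2 by norm_num)] with t ht
    have hq : sqDist c (P + t • (c - P)) = (1 - t) ^ 2 * R ^ 2 := by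
      rw [← hP]; simp [sqDist]; ring
    have := hcomp (P + t • (c - P))
      (by
        have : (1 / 2) ^ 2 ≤ (1 - t) ^ 2 := by nlinarith [ht.1, ht.2]
        rw [hq]; nlinarith)
      (by
        have : (1 - t) ^ 2 ≤ 1 := by nlinarith [ht.1, ht.2]
        rw [hq]; nlinarith)
    have hψP : ψ P = -(k * (R ^ 2)⁻¹) := by simp [hψ, barrier, huP, hP]
    simp only [zero_add, zero_smul, add_zero, hψP, smul_eq_mul]
    exact mul_nonneg (inv_nonneg.2 ht.1.le) (by linarith)
  have hbP : fderiv ℝ (barrier c) P (c - P) = 2 / R ^ 2 := by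
    rw [fderiv_barrier_apply hPne, hP]
    have : -(2 * (P.1 - c.1) * (c - P).1 + 2 * (P.2 - c.2) * (c - P).2) = 2 * R ^ 2 := by
      rw [← hP]; simp [sqDist]; ring
    rw [this]
    field_simp
  simp only [sub_apply, smul_apply, hbP,
    smul_eq_mul] at hge
  have : 0 < k * (2 / R ^ 2) := by positivity
  linarith

/-- If `φ` is `C¹` with nonzero derivative at `γ 0`, then near `γ 0` the zero set of `φ` is covered
by any regular curve `γ` lying in it. -/
lemma eventually_zero_mem_image {φ : ℝ × ℝ → ℝ} {γ : ℝ → ℝ × ℝ} {ε : ℝ} (hε : 0 < ε)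
    (hφ : ContDiffAt ℝ 1 φ (γ 0)) (hL : fderiv ℝ φ (γ 0) ≠ 0)
    (hγ : ContDiffOn ℝ 1 γ (Set.Ioo (-ε) ε)) (hγ0 : deriv γ 0 ≠ 0)
    (hzero : ∀ t ∈ Set.Ioo (-ε) ε, φ (γ t) = 0) :
    ∀ᶠ x in 𝓝 (γ 0), φ x = 0 → x ∈ γ '' Set.Ioo (-ε) ε := by
  set L := fderiv ℝ φ (γ 0) with hLdef
  set a := L (1, 0) with ha
  set b := L (0, 1) with hb
  have hLapply : ∀ p : ℝ × ℝ, L p = a * p.1 + b * p.2 := by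
    intro p
    have : p = p.1 • ((1, 0) : ℝ × ℝ) + p.2 • ((0, 1) : ℝ × ℝ) := by ext <;> simp
    conv_lhs => rw [this]
    rw [map_add, map_smul, map_smul, smul_eq_mul, smul_eq_mul]
    ring
  have hab : 0 < a ^ 2 + b ^ 2 := by
    by_contra! h
    have h1 : a = 0 := by nlinarith [sq_nonneg a, sq_nonneg b]
    have h2 : b = 0 := by nlinarith [sq_nonneg a, sq_nonneg b]
    exact hL (ContinuousLinearMap.ext fun p => by simp [hLapply, h1, h2])
  have hI : Set.Ioo (-ε) ε ∈ 𝓝 (0 : ℝ) := Ioo_mem_nhds (by linarith) hε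
  have hγat : ContDiffAt ℝ 1 γ 0 := hγ.contDiffAt hI
  have hstrict : HasStrictDerivAt γ (deriv γ 0) 0 := hγat.hasStrictDerivAt (by norm_num)
  have hLv : L (deriv γ 0) = 0 := by
    have h1 : HasDerivAt (fun t => φ (γ t)) (L (deriv γ 0)) 0 :=
      (hφ.differentiableAt (by norm_num)).hasFDerivAt.comp_hasDerivAt 0 hstrict.hasDerivAt
    have h2 : (fun t => φ (γ t)) =ᶠ[𝓝 0] fun _ => (0 : ℝ) := by
      filter_upwards [hI] with t ht using hzero t ht
    rw [← h1.deriv, h2.deriv_eq]; simp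
  set M : ℝ × ℝ →L[ℝ] ℝ :=
    a • ContinuousLinearMap.snd ℝ ℝ ℝ - b • ContinuousLinearMap.fst ℝ ℝ ℝ with hM
  have hMapply : ∀ p : ℝ × ℝ, M p = a * p.2 - b * p.1 := fun p => by simp [hM]
  have hMv : M (deriv γ 0) ≠ 0 := by
    intro h
    rw [hMapply] at h
    rw [hLapply] at hLv
    apply hγ0
    have h1 : (a ^ 2 + b ^ 2) * (deriv γ 0).1 = 0 := by linear_combination a * hLv - b * h
    have h2 : (a ^ 2 + b ^ 2) * (deriv γ 0).2 = 0 := by linear_combination b * hLv + a * h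
    ext
    · simpa [hab.ne'] using h1
    · simpa [hab.ne'] using h2
  have hg : HasStrictDerivAt (fun t => M (γ t)) (M (deriv γ 0)) 0 :=
    M.hasStrictFDerivAt.comp_hasStrictDerivAt 0 hstrict
  have hnhds := hg.map_nhds_eq hMv
  have hgood : ∀ᶠ p in 𝓝 (γ 0), DifferentiableAt ℝ φ p ∧ fderiv ℝ φ p (a, b) ≠ 0 := by
    have hc : ContinuousAt (fun p => fderiv ℝ φ p (a, b)) (γ 0) :=
      (hφ.fderiv_right (m := 0) (by norm_num)).continuousAt.clm_apply continuousAt_const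
    have hne : fderiv ℝ φ (γ 0) (a, b) ≠ 0 := by
      rw [← hLdef, hLapply]; simp only; nlinarith
    filter_upwards [hφ.eventually (by simp), hc.eventually_ne hne] with p h1 h2
    exact ⟨h1.differentiableAt (by norm_num), h2⟩
  obtain ⟨δ, hδ, hball⟩ := Metric.eventually_nhds_iff_ball.1 hgood
  have hW : Set.Ioo (-ε) ε ∩ γ ⁻¹' Metric.ball (γ 0) δ ∈ 𝓝 (0 : ℝ) :=
    inter_mem hI (hstrict.hasDerivAt.continuousAt (Metric.ball_mem_nhds _ hδ))
  have himg := image_mem_map (m := fun t => M (γ t)) hW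
  rw [hnhds] at himg
  filter_upwards [M.continuous.continuousAt.preimage_mem_nhds himg, Metric.ball_mem_nhds _ hδ]
    with x hx1 hx2 hx0
  obtain ⟨t, ⟨ht1, ht2⟩, htx⟩ := hx1
  refine ⟨t, ht1, ?_⟩
  obtain ⟨z, hz, hmvt⟩ := domain_mvt (f := φ) (f' := fun p => fderiv ℝ φ p)
    (fun p hp => (hball p hp).1.hasFDerivAt.hasFDerivWithinAt) (convex_ball (γ 0) δ) ht2 hx2
  have hzb := (hball z ((convex_ball (γ 0) δ).segment_subset ht2 hx2 hz)).2
  simp only [hMapply] at htx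
  set s := (a * (x.1 - (γ t).1) + b * (x.2 - (γ t).2)) / (a ^ 2 + b ^ 2) with hs
  have hxs : x - γ t = s • (a, b) := by
    ext
    · simp only [Prod.fst_sub, Prod.smul_fst, smul_eq_mul, hs]
      field_simp
      linear_combination b * htx
    · simp only [Prod.snd_sub, Prod.smul_snd, smul_eq_mul, hs]
      field_simp
      linear_combination -a * htx
  rw [hx0, hzero t ht1, hxs, map_smul, sub_zero, smul_eq_mul] at hmvt
  have hs0 : s = 0 := by
    rcases mul_eq_zero.1 hmvt.symm with h | h
    · exact h
    · exact absurd h hzb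
  rw [hs0, zero_smul, sub_eq_zero] at hxs
  exact hxs.symm

theorem normal_derivative_zero_iff_in_nodal_set
    (Ω : Set (ℝ × ℝ)) (hΩ : IsOpen Ω) (hΩbd : Bornology.IsBounded Ω)
    (hman : IsC1Submanifold1D (frontier Ω))
    (hballs : ∀ P ∈ frontier Ω, InteriorBall Ω P)
    (lam : ℝ) (hlam : 0 ≤ lam)
    (φ : ℝ × ℝ → ℝ)
    (V : Set (ℝ × ℝ)) (hV : IsOpen V) (hclV : closure Ω ⊆ V)
    (hφ1 : ContDiffOn ℝ 1 φ V) (hφ2 : ContDiffOn ℝ 2 φ Ω)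
    (heq : ∀ x ∈ Ω, lap φ x + lam * φ x = 0)
    (hbc : ∀ x ∈ frontier Ω, φ x = 0) :
    ∀ P ∈ frontier Ω, (fderiv ℝ φ P = 0 ↔ P ∈ closure {x ∈ Ω | φ x = 0}) := by
  intro P hP
  have hPV : V ∈ 𝓝 P := hV.mem_nhds (hclV (frontier_subset_closure hP))
  have hφP : ContDiffAt ℝ 1 φ P := hφ1.contDiffAt hPV
  constructor
  · intro hzero
    by_contra hncl
    rw [mem_closure_iff_nhds_basis Metric.nhds_basis_closedBall] at hncl
    push Not at hncl
    obtain ⟨r, hr, hr0⟩ := hncl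
    obtain ⟨c, ρ, hρ, hsub, hcP⟩ := hballs P hP
    obtain ⟨s, hs0, hs1, hsr⟩ : ∃ s : ℝ, 0 < s ∧ s ≤ 1 ∧ 2 * (s * ρ) ≤ r := by
      refine ⟨min 1 (r / (2 * ρ)), by positivity, min_le_left _ _, ?_⟩
      have := (le_div_iff₀ (by positivity)).1 (min_le_right 1 (r / (2 * ρ)))
      linarith
    set c' : ℝ × ℝ := P + s • (c - P) with hc'
    have hR : 0 < s * ρ := by positivity
    have hc'P : sqDist c' P = (s * ρ) ^ 2 := by
      rw [mul_pow, ← hcP]; simp [sqDist, hc']; ring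
    have hball : {x | sqDist c' x < (s * ρ) ^ 2} ⊆ Ω := fun x hx =>
      hsub (sqDist_lt_of_internally_tangent hs0 hs1 hcP hx)
    have hdisc : {x | sqDist c' x ≤ (s * ρ) ^ 2} ⊆ V := fun x hx =>
      hclV (closure_mono hball (mem_closure_sqDist_lt (by positivity) hx))
    have hne : ∀ x, sqDist c' x < (s * ρ) ^ 2 → φ x ≠ 0 := by
      intro x hx hx0
      refine hr0 x ⟨hball hx, hx0⟩ ?_
      have h1 := dist_le_of_sqDist_le hR.le hx.le
      have h2 := dist_le_of_sqDist_le hR.le hc'P.le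
      rw [Metric.mem_closedBall]
      linarith [dist_triangle_right x P c']
    have hcont : ContinuousOn φ {x | sqDist c' x ≤ (s * ρ) ^ 2} := hφ1.continuousOn.mono hdisc
    have hC2 : ContDiffOn ℝ 2 φ {x | sqDist c' x < (s * ρ) ^ 2} := hφ2.mono hball
    have hconn := (convex_sqDist_lt c' ((s * ρ) ^ 2)).isPreconnected
    have hcc : sqDist c' c' < (s * ρ) ^ 2 := by simp [sqDist]; positivity
    have hd := hφP.differentiableAt (by norm_num)
    rcases lt_or_gt_of_ne (hne c' hcc) with hneg | hpos
    · have hneg' : ∀ x, sqDist c' x < (s * ρ) ^ 2 → φ x < 0 := by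
        intro x hx
        by_contra! h
        obtain ⟨y, hy, hy0⟩ := hconn.intermediate_value hcc hx hC2.continuousOn ⟨hneg.le, h⟩
        exact hne y hy hy0
      have := hopf_boundary_point hR hc'P (u := fun x => -φ x) hcont.neg hC2.neg
        (fun x hx => neg_pos.2 (hneg' x hx))
        (fun x hx => by
          rw [lap_neg]
          nlinarith [heq x (hball hx), hneg' x hx])
        (by simp [hbc P hP]) hd.neg
      simp [fderiv_fun_neg, hzero] at this
    · have hpos' : ∀ x, sqDist c' x < (s * ρ) ^ 2 → 0 < φ x := by
        intro x hx
        by_contra! h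
        obtain ⟨y, hy, hy0⟩ := hconn.intermediate_value hx hcc hC2.continuousOn ⟨h, hpos.le⟩
        exact hne y hy hy0
      have := hopf_boundary_point hR hc'P hcont hC2 hpos'
        (fun x hx => by nlinarith [heq x (hball hx), hpos' x hx]) (hbc P hP) hd
      simp [hzero] at this
  · intro hcl
    by_contra hL
    obtain ⟨U, γ, ε, hε, hU, hPU, hγ, rfl, hγ0, himg⟩ := hman P hP
    have hfr : ∀ t ∈ Set.Ioo (-ε) ε, γ t ∈ frontier Ω := fun t ht =>
      (himg.subset (Set.mem_image_of_mem γ ht)).1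
    obtain ⟨x, ⟨hxΩ, hx0⟩, hx⟩ := ((mem_closure_iff_frequently.1 hcl).and_eventually
      (eventually_zero_mem_image hε hφP hL hγ hγ0 fun t ht => hbc _ (hfr t ht))).exists
    obtain ⟨t, ht, rfl⟩ := hx hx0
    exact (hΩ.frontier_eq ▸ hfr t ht).2 hxΩ
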